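/- arXiv:2006.00320 — 3 statements merged into one kernel-verified Lean document; each statement's English description precedes it below -/
import Mathlib

section
/- Every cancellative commutative locally compact Hausdorff semitopological semigroup with open shifts has continuous division: for all x, y ∈ S and every open set V containing y, there exist open sets U and W containing x and xy respectively such that W ⊆ ⋂_{u∈U} uV. -/
open Filter Topology

theorem exists_seq_of_forall_exists {α : Type*} {P : α → Prop} {r : α → α → Prop} {a : α}
    (ha : P a) (h : ∀ x, P x → ∃ y, P y ∧ r x y) :
    ∃ f : ℕ → α, f 0 = a ∧ ∀ n, P (f n) ∧ r (f n) (f (n + 1)) := by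
  choose g hgP hgr using h
  let F : ℕ → {x // P x} := fun n => Nat.rec ⟨a, ha⟩ (fun _ x => ⟨g x.1 x.2, hgP x.1 x.2⟩) n
  exact ⟨fun n => (F n).1, rfl, fun n => ⟨(F n).2, hgr _ _⟩⟩

/-- A sequence in a compact set converges along the hyperfilter on `ℕ`. -/
theorem IsCompact.exists_tendsto_hyperfilter {X : Type*} [TopologicalSpace X] {K : Set X}
    (hK : IsCompact K) {f : ℕ → X} (hf : ∀ n, f n ∈ K) :
    ∃ x ∈ K, Tendsto f (hyperfilter ℕ : Filter ℕ) (𝓝 x) :=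
  hK.ultrafilter_le_nhds ((hyperfilter ℕ).map f)
    (tendsto_principal.2 (Eventually.of_forall hf))

theorem eventually_hyperfilter_ge (n : ℕ) : ∀ᶠ m in (hyperfilter ℕ : Filter ℕ), n ≤ m :=
  Nat.hyperfilter_le_atTop (eventually_ge_atTop n)

section

variable {S : Type*} [CommSemigroup S] [TopologicalSpace S] [T2Space S] [LocallyCompactSpace S]

/-- A form of strong quasicontinuity of a separately continuous multiplication. -/
theorem exists_isOpen_mul_mem_compact (hc : ∀ a : S, Continuous fun s : S => a * s) (x z : S) :
    ∃ P V R : Set S, IsOpen P ∧ P.Nonempty ∧ IsOpen V ∧ z ∈ V ∧ IsCompact R ∧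
      ∀ u ∈ P, ∀ v ∈ V, u * v ∈ R := by
  have hc' : ∀ a : S, Continuous fun s : S => s * a := fun a => by
    simpa only [mul_comm] using hc a
  obtain ⟨C, hC, hxzC⟩ := exists_compact_mem_nhds (x * z)
  obtain ⟨R, hR, hCR⟩ := exists_compact_superset hC
  obtain ⟨X, hX, hxX⟩ := exists_compact_mem_nhds x
  obtain ⟨Z, hZ, hzZ⟩ := exists_compact_mem_nhds z
  by_contra! hcon
  let U₀ : Set S := interior X ∩ (fun s => s * z) ⁻¹' interior C
  have hU₀ : IsOpen U₀ := isOpen_interior.inter (isOpen_interior.preimage (hc' z))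
  have hxU₀ : x ∈ U₀ := ⟨mem_interior_iff_mem_nhds.2 hxX, mem_interior_iff_mem_nhds.2 hxzC⟩
  obtain ⟨f, hf0, hf⟩ := exists_seq_of_forall_exists
    (P := fun s : Set S × Set S => IsOpen s.1 ∧ s.1.Nonempty ∧ s.1 ⊆ U₀ ∧ IsOpen s.2 ∧ z ∈ s.2)
    (r := fun s t => t.1 ⊆ s.1 ∧ t.2 ⊆ s.2 ∧ ∃ a ∈ s.1, ∃ b ∈ s.2,
      (∀ u ∈ t.1, u * b ∉ R) ∧ ∀ v ∈ t.2, a * v ∈ C)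
    (a := (U₀, interior Z))
    ⟨hU₀, ⟨x, hxU₀⟩, subset_rfl, isOpen_interior, mem_interior_iff_mem_nhds.2 hzZ⟩ (by
      rintro ⟨U, V⟩ ⟨hU, hUne, hUU₀, hV, hzV⟩
      obtain ⟨a, ha, b, hb, hab⟩ := hcon U V R hU hUne hV hzV hR
      refine ⟨(U ∩ (fun s => s * b) ⁻¹' Rᶜ, V ∩ (fun s => a * s) ⁻¹' interior C),
        ⟨hU.inter (hR.isClosed.isOpen_compl.preimage (hc' b)), ⟨a, ha, hab⟩,
          Set.inter_subset_left.trans hUU₀, hV.inter (isOpen_interior.preimage (hc a)),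
          hzV, (hUU₀ ha).2⟩,
        Set.inter_subset_left, Set.inter_subset_left, a, ha, b, hb, fun u hu => hu.2,
        fun v hv => interior_subset hv.2⟩)
  have hU : Antitone fun n => (f n).1 := antitone_nat_of_succ_le fun n => (hf n).2.1
  have hV : Antitone fun n => (f n).2 := antitone_nat_of_succ_le fun n => (hf n).2.2.1
  choose a ha b hb hbR haC using fun n => (hf n).2.2.2
  obtain ⟨p, -, hp⟩ := hX.exists_tendsto_hyperfilter
    (f := a) fun n => interior_subset ((hf n).1.2.2.1 (ha n)).1
  obtain ⟨q, -, hq⟩ := hZ.exists_tendsto_hyperfilter (f := b) fun n => interior_subset (by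
    simpa only [hf0] using hV (Nat.zero_le n) (hb n))
  have h₁ : p * q ∈ C := hC.isClosed.mem_of_tendsto (((hc' q).tendsto p).comp hp) <|
    Eventually.of_forall fun n => hC.isClosed.mem_of_tendsto (((hc (a n)).tendsto q).comp hq) <|
      (eventually_hyperfilter_ge (n + 1)).mono fun m hm => haC n _ (hV hm (hb m))
  have h₂ : p * q ∈ (interior R)ᶜ :=
    isOpen_interior.isClosed_compl.mem_of_tendsto (((hc p).tendsto q).comp hq) <|
    Eventually.of_forall fun n =>
      isOpen_interior.isClosed_compl.mem_of_tendsto (((hc' (b n)).tendsto p).comp hp) <|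
      (eventually_hyperfilter_ge (n + 1)).mono fun m hm h =>
        hbR n _ (hU hm (ha m)) (interior_subset h)
  exact h₂ (hCR h₁)

variable [IsCancelMul S]

/-- Quotients `a⁻¹ * b * k` with `a`, `b` in a suitable nonempty open set exist and stay in a
compact set. -/
theorem exists_isOpen_div_mem_compact (hc : ∀ a : S, Continuous fun s : S => a * s)
    (ho : ∀ a : S, IsOpenMap fun s : S => a * s) (x : S) :
    ∃ (k : S) (Q R : Set S), IsOpen Q ∧ Q.Nonempty ∧ IsCompact R ∧
      ∀ a ∈ Q, ∀ b ∈ Q, ∃ r ∈ R, b * k = a * r := by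
  have hc' : ∀ a : S, Continuous fun s : S => s * a := fun a => by
    simpa only [mul_comm] using hc a
  obtain ⟨P, V, R, hP, ⟨c, hcP⟩, hV, hxV, hR, hPVR⟩ := exists_isOpen_mul_mem_compact hc x x
  obtain ⟨X, hX, hxX⟩ := exists_compact_mem_nhds x
  by_contra! hcon
  obtain ⟨U, hU0, hU⟩ := exists_seq_of_forall_exists
    (P := fun s : Set S => IsOpen s ∧ s.Nonempty)
    (r := fun s t => closure t ⊆ s ∧ ∃ a ∈ s, ∃ b ∈ s,
      (∀ r ∈ R, b * (c * x) ≠ a * r) ∧ ∀ u ∈ t, ∃ s ∈ P, a * s = u * c)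
    (a := interior X) ⟨isOpen_interior, x, mem_interior_iff_mem_nhds.2 hxX⟩ (by
      rintro U ⟨hU, hUne⟩
      obtain ⟨a, ha, b, hb, hab⟩ := hcon (c * x) U R hU hUne hR
      have hO : IsOpen (U ∩ (fun s => s * c) ⁻¹' ((fun s => a * s) '' P)) :=
        hU.inter ((ho a P hP).preimage (hc' c))
      obtain ⟨K, hK, haK, hKO⟩ := exists_compact_subset hO ⟨ha, c, hcP, rfl⟩
      exact ⟨interior K, ⟨isOpen_interior, a, haK⟩,
        (closure_minimal interior_subset hK.isClosed).trans (hKO.trans Set.inter_subset_left),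
        a, ha, b, hb, hab, fun u hu => (hKO (interior_subset hu)).2⟩)
  have hanti : Antitone U :=
    antitone_nat_of_succ_le fun n => subset_closure.trans (hU n).2.1
  choose a ha b hb hab hP' using fun n => (hU n).2.2
  obtain ⟨p, -, hp⟩ := hX.exists_tendsto_hyperfilter (f := b) fun n => interior_subset (by
    have := hanti (Nat.zero_le n) (hb n)
    rwa [hU0] at this)
  have hpU : ∀ n, p ∈ U n := fun n => (hU n).2.1 <| mem_closure_of_tendsto hp <|
    (eventually_hyperfilter_ge (n + 1)).mono fun m hm => hanti hm (hb m)
  obtain ⟨n, t, ht, htn⟩ := ((((hc' x).tendsto p).comp hp).eventually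
    ((ho p V hV).mem_nhds ⟨x, hxV, rfl⟩)).exists
  obtain ⟨s, hs, hsn⟩ := hP' n p (hpU (n + 1))
  refine hab n (s * t) (hPVR s hs t ht) (mul_left_cancel (a := p) ?_)
  simp only [Function.comp_apply] at htn
  calc p * (b n * (c * x)) = (p * c) * (b n * x) := by ac_rfl
    _ = (a n * s) * (p * t) := by rw [hsn, htn]
    _ = p * (a n * (s * t)) := by ac_rfl

/-- If the quotients `a⁻¹ * b * y` with `a`, `b` in some nonempty open set stay in a compact set,
then on a smaller nonempty open set they stay in any given neighborhood of `y`. -/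
theorem exists_isOpen_div_mem_of_compact (hc : ∀ a : S, Continuous fun s : S => a * s)
    (ho : ∀ a : S, IsOpenMap fun s : S => a * s) {y : S} {Q R V : Set S} (hQ : IsOpen Q)
    (hQne : Q.Nonempty) (hR : IsCompact R) (hQR : ∀ a ∈ Q, ∀ b ∈ Q, ∃ r ∈ R, b * y = a * r)
    (hV : IsOpen V) (hy : y ∈ V) :
    ∃ Q' : Set S, IsOpen Q' ∧ Q'.Nonempty ∧ ∀ a ∈ Q', ∀ b ∈ Q', ∃ v ∈ V, b * y = a * v := by
  have hc' : ∀ a : S, Continuous fun s : S => s * a := fun a => by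
    simpa only [mul_comm] using hc a
  have ho' : ∀ a : S, IsOpenMap fun s : S => s * a := fun a => by
    simpa only [mul_comm] using ho a
  obtain ⟨C₁, hC₁, hyC₁, hC₁V⟩ := exists_compact_subset hV hy
  obtain ⟨C₀, hC₀, hyC₀, hC₀₁⟩ := exists_compact_subset isOpen_interior hyC₁
  obtain ⟨x, hx⟩ := hQne
  obtain ⟨X, hX, hxX, hXQ⟩ := exists_compact_subset hQ hx
  by_contra! hcon
  obtain ⟨f, -, hf⟩ := exists_seq_of_forall_exists
    (P := fun s : Set S × Set S =>
      IsOpen s.1 ∧ s.1.Nonempty ∧ s.1 ⊆ X ∧ IsOpen s.2 ∧ y ∈ s.2 ∧ s.2 ⊆ C₀)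
    (r := fun s t => closure t.1 ⊆ s.1 ∧ t.2 ⊆ s.2 ∧ ∃ a ∈ s.1, ∃ w ∈ R,
      (∀ u ∈ t.1, u * w ∈ (fun q => q * y) '' s.1) ∧ (∀ u ∈ t.1, ∃ v ∈ t.2, a * v = u * y) ∧
      ∀ v ∈ t.2, v * w ∉ (fun q => y * q) '' C₁)
    (a := (interior X, interior C₀))
    ⟨isOpen_interior, ⟨x, hxX⟩, interior_subset, isOpen_interior, hyC₀, interior_subset⟩ (by
      rintro ⟨U, T⟩ ⟨hU, hUne, hUX, hT, hyT, hTC⟩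
      obtain ⟨a, ha, b, hb, hab⟩ := hcon U hU hUne
      obtain ⟨w, hw, hbw⟩ := hQR a (hXQ (hUX ha)) b (hXQ (hUX hb))
      have hT' : IsOpen (T ∩ (fun v => v * w) ⁻¹' ((fun q => y * q) '' C₁)ᶜ) :=
        hT.inter ((hC₁.image (hc y)).isClosed.isOpen_compl.preimage (hc' w))
      have hyT' : y ∈ T ∩ (fun v => v * w) ⁻¹' ((fun q => y * q) '' C₁)ᶜ := by
        refine ⟨hyT, ?_⟩
        rintro ⟨q, hq, hqw⟩
        exact hab w (hC₁V (mul_left_cancel hqw ▸ hq)) hbw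
      have hO : IsOpen (U ∩ (fun u => u * w) ⁻¹' ((fun q => q * y) '' U) ∩ (fun u => u * y) ⁻¹'
          ((fun v => a * v) '' (T ∩ (fun v => v * w) ⁻¹' ((fun q => y * q) '' C₁)ᶜ))) :=
        (hU.inter ((ho' y U hU).preimage (hc' w))).inter ((ho a _ hT').preimage (hc' y))
      obtain ⟨K, hK, haK, hKO⟩ := exists_compact_subset hO
        ⟨⟨ha, b, hb, hbw⟩, y, hyT', rfl⟩
      have hKU : K ⊆ U := fun u hu => (hKO hu).1.1
      exact ⟨(interior K, _), ⟨isOpen_interior, ⟨a, haK⟩, interior_subset.trans (hKU.trans hUX),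
        hT', hyT', Set.inter_subset_left.trans hTC⟩,
        (closure_minimal interior_subset hK.isClosed).trans hKU, Set.inter_subset_left,
        a, ha, w, hw, fun u hu => (hKO (interior_subset hu)).1.2,
        fun u hu => (hKO (interior_subset hu)).2, fun v hv => hv.2⟩)
  have hU : Antitone fun n => (f n).1 :=
    antitone_nat_of_succ_le fun n => subset_closure.trans (hf n).2.1
  have hT : Antitone fun n => (f n).2 := antitone_nat_of_succ_le fun n => (hf n).2.2.1
  choose a ha w hw huw huy hvw using fun n => (hf n).2.2.2
  obtain ⟨p, -, hp⟩ := hX.exists_tendsto_hyperfilter (f := a) fun n => (hf n).1.2.2.1 (ha n)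
  obtain ⟨w', -, hw'⟩ := hR.exists_tendsto_hyperfilter hw
  have hpU : ∀ n, p ∈ (f n).1 := fun n => (hf n).2.1 <| mem_closure_of_tendsto hp <|
    (eventually_hyperfilter_ge (n + 1)).mono fun m hm => hU hm (ha m)
  have hpw : ∀ n, ∃ q ∈ (f n).1, q * y = p * w' := fun n => by
    have hK : IsCompact (closure (f (n + 1)).1) :=
      hX.of_isClosed_subset isClosed_closure
        (closure_minimal (hf (n + 1)).1.2.2.1 hX.isClosed)
    have : p * w' ∈ (fun q => q * y) '' closure (f (n + 1)).1 :=
      (hK.image (hc' y)).isClosed.mem_of_tendsto (((hc p).tendsto w').comp hw') <|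
      (eventually_hyperfilter_ge (n + 1)).mono fun m hm =>
        Set.image_mono ((hU hm).trans subset_closure) (huw m p (hpU (m + 1)))
    exact Set.image_mono (hf n).2.1 this
  choose v hvT hv using fun n => huy n p (hpU (n + 1))
  obtain ⟨v', -, hv'⟩ := hC₀.exists_tendsto_hyperfilter
    (f := v) fun n => (hf (n + 1)).1.2.2.2.2.2 (hvT n)
  have h₁ : v' * w' ∈ (fun q => y * q) '' C₀ :=
    (hC₀.image (hc y)).isClosed.mem_of_tendsto (((hc' w').tendsto v').comp hv') <|
    Eventually.of_forall fun n => by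
      obtain ⟨q, hq, hqp⟩ := hpw (n + 1)
      obtain ⟨t, ht, htq⟩ := huy n q hq
      refine ⟨t, (hf (n + 1)).1.2.2.2.2.2 ht, mul_left_cancel (a := a n) ?_⟩
      calc a n * (y * t) = (a n * t) * y := by ac_rfl
        _ = (p * w') * y := by rw [htq, hqp]
        _ = (p * y) * w' := by ac_rfl
        _ = a n * (v n * w') := by rw [← hv n, mul_assoc]
  have h₂ : v' * w' ∈ ((fun q => y * q) '' interior C₁)ᶜ :=
    (ho y _ isOpen_interior).isClosed_compl.mem_of_tendsto (((hc v').tendsto w').comp hw') <|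
    Eventually.of_forall fun n =>
      (ho y _ isOpen_interior).isClosed_compl.mem_of_tendsto (((hc' (w n)).tendsto v').comp hv') <|
      (eventually_hyperfilter_ge n).mono fun m hm h =>
        hvw n (v m) (hT (Nat.succ_le_succ hm) (hvT m)) (Set.image_mono interior_subset h)
  exact h₂ (Set.image_mono hC₀₁ h₁)

end

/-- Every cancellative commutative locally compact Hausdorff semitopological
semigroup with open shifts has continuous division: for all `x y ∈ S` and every open `V`
containing `y`, there are open sets `U ∋ x` and `W ∋ x*y` with `W ⊆ ⋂_{u ∈ U} uV`. -/
theorem continuous_division_of_locallyCompact_t2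
    {S : Type*} [CommSemigroup S] [IsCancelMul S] [TopologicalSpace S]
    [T2Space S] [WeaklyLocallyCompactSpace S]
    (hc : ∀ a : S, Continuous fun s : S => a * s)
    (ho : ∀ a : S, IsOpenMap fun s : S => a * s) :
    ∀ x y : S, ∀ V : Set S, IsOpen V → y ∈ V →
      ∃ U W : Set S, IsOpen U ∧ IsOpen W ∧ x ∈ U ∧ x * y ∈ W ∧
        ∀ u ∈ U, W ⊆ (fun v => u * v) '' V := by
  intro x y V hV hy
  have hc' : ∀ a : S, Continuous fun s : S => s * a := fun a => by
    simpa only [mul_comm] using hc a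
  obtain ⟨k, Q₀, R, hQ₀, hQ₀ne, hR, hQR⟩ := exists_isOpen_div_mem_compact hc ho x
  obtain ⟨Q, hQ, ⟨q, hq⟩, hQV⟩ := exists_isOpen_div_mem_of_compact hc ho
    (y := k * y) (R := (fun r => r * y) '' R) (V := (fun v => k * v) '' V) hQ₀ hQ₀ne
    (hR.image (hc' y)) (fun a ha b hb => by
      obtain ⟨r, hr, hbr⟩ := hQR a ha b hb
      exact ⟨r * y, ⟨r, hr, rfl⟩, by rw [← mul_assoc, hbr, mul_assoc]⟩)
    (ho k V hV) ⟨y, hy, rfl⟩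
  refine ⟨(fun u => u * q) ⁻¹' ((fun s => x * s) '' Q),
    (fun w => w * q) ⁻¹' ((fun s => x * y * s) '' Q), (ho x Q hQ).preimage (hc' q),
    (ho (x * y) Q hQ).preimage (hc' q), ⟨q, hq, rfl⟩, ⟨q, hq, rfl⟩, ?_⟩
  rintro u ⟨a, ha, hau⟩ w ⟨b, hb, hbw⟩
  obtain ⟨-, ⟨v, hv, rfl⟩, hab⟩ := hQV a ha b hb
  refine ⟨v, hv, mul_left_cancel (a := q * k) ?_⟩
  simp only at hau hbw hab ⊢
  calc q * k * (u * v) = (u * q) * (k * v) := by ac_rfl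
    _ = x * (a * (k * v)) := by rw [← hau, mul_assoc]
    _ = x * (b * (k * y)) := by rw [hab]
    _ = k * (x * y * b) := by ac_rfl
    _ = q * k * w := by rw [hbw]; ac_rfl
end

section
/- Every cancellative commutative locally compact connected Hausdorff topological monoid with open shifts is a topological group; that is, every element of S is invertible and inversion x ↦ x⁻¹ is continuous. -/
open Filter Topology Pointwise

theorem image_mul_left_mem_nhds {S : Type*} [MulOneClass S] [TopologicalSpace S]
    (ho : ∀ a : S, IsOpenMap fun s : S => a * s) (a : S) {V : Set S} (hV : V ∈ 𝓝 (1 : S)) :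
    (fun s => a * s) '' V ∈ 𝓝 a := by
  simpa only [mul_one] using (ho a).image_mem_nhds hV

/-- In a commutative cancellative monoid with open shifts, all elements close to `1` have inverses
in `C * C`, for every compact neighborhood `C` of `1`. -/
theorem eventually_exists_mul_eq_one_of_isCompact
    {S : Type*} [CommMonoid S] [IsCancelMul S] [TopologicalSpace S] [T2Space S] [ContinuousMul S]
    (ho : ∀ a : S, IsOpenMap fun s : S => a * s) {C : Set S} (hC : IsCompact C)
    (hC1 : C ∈ 𝓝 (1 : S)) : ∀ᶠ x in 𝓝 (1 : S), ∃ y ∈ C * C, x * y = 1 := by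
  by_contra hbad
  have split (V : {V : Set S // V ∈ 𝓝 (1 : S)}) :
      ∃ W : {V : Set S // V ∈ 𝓝 (1 : S)}, ∀ v ∈ W.1, ∀ w ∈ W.1, v * w ∈ V.1 := by
    obtain ⟨W, hW, h⟩ := exists_nhds_one_split V.2
    exact ⟨⟨W, hW⟩, h⟩
  choose half hhalf using split
  let W : ℕ → {V : Set S // V ∈ 𝓝 (1 : S)} := fun n => half^[n] ⟨C, hC1⟩
  have hW (n : ℕ) : ∀ v ∈ (W (n + 1)).1, ∀ w ∈ (W (n + 1)).1, v * w ∈ (W n).1 := by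
    simp only [W, Function.iterate_succ_apply']
    exact hhalf _
  have hone (n : ℕ) : (1 : S) ∈ (W n).1 := mem_of_mem_nhds (W n).2
  have hWC (n : ℕ) : (W n).1 ⊆ C := by
    induction n with
    | zero => exact subset_rfl
    | succ n ih => exact fun v hv => ih (by simpa using hW n v hv 1 (hone _))
  have hx (n : ℕ) : ∃ x ∈ (W (n + 1)).1, ¬ ∃ y ∈ C * C, x * y = 1 := by
    by_contra! h
    exact hbad (mem_of_superset (W (n + 1)).2 h)
  choose x hxW hxbad using hx
  have htail (k n : ℕ) : ∏ i ∈ Finset.range k, x (n + i) ∈ (W n).1 := by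
    induction k generalizing n with
    | zero => simpa using hone n
    | succ k ih =>
      rw [Finset.prod_range_succ', mul_comm]
      refine hW n _ (hxW n) _ ?_
      simpa only [add_assoc, add_comm, add_left_comm] using ih (n + 1)
  let p : ℕ → S := fun n => ∏ i ∈ Finset.range n, x i
  have hpC (n : ℕ) : p n ∈ C := hWC 0 (by simpa using htail n 0)
  obtain ⟨q, -, hq⟩ := hC.exists_mapClusterPt (f := atTop) (u := p)
    (tendsto_principal.2 (Eventually.of_forall hpC))
  obtain ⟨n, v, hv, hn⟩ := (hq.frequently
    (image_mul_left_mem_nhds ho q hC1)).exists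
  have hqn : q ∈ (fun s => p (n + 1) * s) '' C := by
    by_contra hmem
    have hclosed := (hC.image (continuous_const_mul (p (n + 1)))).isClosed
    obtain ⟨m, hm, hmn⟩ := ((hq.frequently (hclosed.isOpen_compl.mem_nhds hmem)).and_eventually
      (eventually_ge_atTop (n + 1))).exists
    obtain ⟨k, rfl⟩ := Nat.exists_eq_add_of_le hmn
    exact hm ⟨_, hWC _ (htail k (n + 1)), (Finset.prod_range_add x (n + 1) k).symm⟩
  obtain ⟨t, ht, htq⟩ := hqn
  refine hxbad n ⟨t * v, Set.mul_mem_mul ht hv, mul_left_cancel (a := p n) ?_⟩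
  have hsucc : p (n + 1) = p n * x n := Finset.prod_range_succ x n
  simp only [hsucc] at htq hn
  rw [mul_one, ← mul_assoc, ← mul_assoc, htq, hn]

/-- Every cancellative commutative locally compact connected Hausdorff
topological monoid with open shifts is a topological group: every element is invertible
and inversion is continuous. -/
theorem topologicalGroup_of_connected_locallyCompact_monoid
    {S : Type*} [CommMonoid S] [IsCancelMul S] [TopologicalSpace S]
    [T2Space S] [WeaklyLocallyCompactSpace S] [ConnectedSpace S] [ContinuousMul S]
    (ho : ∀ a : S, IsOpenMap fun s : S => a * s) :
    ∃ inv : S → S, Continuous inv ∧ ∀ x : S, x * inv x = 1 := by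
  obtain ⟨C, hC, hC1⟩ := exists_compact_mem_nhds (1 : S)
  have hF := eventually_exists_mul_eq_one_of_isCompact ho hC hC1
  have htranslate (a : S) : ∀ᶠ x in 𝓝 a, ∃ z, (∃ y ∈ C * C, z * y = 1) ∧ a * z = x :=
    image_mul_left_mem_nhds ho a hF
  have hopen : IsOpen {x : S | IsUnit x} := by
    refine isOpen_iff_mem_nhds.2 fun a ha => (htranslate a).mono ?_
    rintro _ ⟨z, ⟨y, -, hy⟩, rfl⟩
    exact IsUnit.mul ha (IsUnit.of_mul_eq_one y hy)
  have hclosed : IsClosed {x : S | IsUnit x} := by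
    refine ⟨isOpen_iff_mem_nhds.2 fun a ha => (htranslate a).mono ?_⟩
    rintro _ ⟨z, -, rfl⟩ h
    exact ha (isUnit_of_mul_isUnit_left h)
  have huniv := IsClopen.eq_univ ⟨hclosed, hopen⟩ ⟨1, isUnit_one⟩
  choose inv hinv using fun x : S => (Set.eq_univ_iff_forall.1 huniv x).exists_right_inv
  refine ⟨inv, continuous_iff_continuousAt.2 fun a => ?_, hinv⟩
  refine ((hC.mul hC).image (continuous_const_mul (inv a))).tendsto_nhds_of_unique_mapClusterPt
    ((htranslate a).mono ?_) fun b _ hb => ?_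
  · rintro _ ⟨z, ⟨y, hyC, hy⟩, rfl⟩
    refine ⟨y, hyC, mul_left_cancel (a := a * z) ?_⟩
    simp only [hinv]
    rw [mul_mul_mul_comm, hinv, hy, one_mul]
  · obtain ⟨U, hU, hUb⟩ := mapClusterPt_iff_ultrafilter.1 hb
    have hlim : Tendsto (fun x => x * inv x) U (𝓝 (a * b)) := Tendsto.mul hU hUb
    simp only [hinv] at hlim
    refine mul_left_cancel (a := a) ?_
    rw [hinv]
    exact tendsto_nhds_unique hlim tendsto_const_nhds
end

section
/- Let S be a commutative cancellative locally compact pseudocompact Hausdorff topological semigroup with open shifts and let K be any subsemigroup of S. Then K (with the subspace topology) has countable cellularity; that is, every pairwise disjoint family of nonempty open subsets of K is countable. -/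
open Filter Topology Set

/-- In a locally compact Hausdorff abelian group with continuous multiplication, inversion is
continuous at the identity. -/
theorem inv_mem_nhds_one_of_continuousMul {G : Type*} [CommGroup G] [TopologicalSpace G]
    [T2Space G] [WeaklyLocallyCompactSpace G] [ContinuousMul G] {U : Set G} (hU : U ∈ 𝓝 (1 : G)) :
    {x : G | x⁻¹ ∈ U} ∈ 𝓝 (1 : G) := by
  by_contra hcon
  have split : ∀ V : Set G, V ∈ 𝓝 (1 : G) →
      ∃ W : Set G, W ∈ 𝓝 (1 : G) ∧ IsCompact W ∧ ∀ a ∈ W, ∀ b ∈ W, a * b ∈ V := by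
    intro V hV
    obtain ⟨O, hOo, hO1, hO⟩ := exists_open_nhds_one_split hV
    obtain ⟨W, hW, hWO, hWc⟩ := local_compact_nhds (hOo.mem_nhds hO1)
    exact ⟨W, hW, hWc, fun a ha b hb => hO a (hWO ha) b (hWO hb)⟩
  choose! next hnext_nhds hnext_compact hnext_mul using split
  let W : ℕ → Set G := fun n => Nat.rec (next U) (fun _ V => next V) n
  have hW : ∀ n, W n ∈ 𝓝 (1 : G) := by
    intro n
    induction n with
    | zero => exact hnext_nhds U hU
    | succ n ih => exact hnext_nhds _ ih
  have hWc : ∀ n, IsCompact (W n) := by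
    intro n
    cases n with
    | zero => exact hnext_compact U hU
    | succ n => exact hnext_compact _ (hW n)
  have hWmul : ∀ n, ∀ a ∈ W (n + 1), ∀ b ∈ W (n + 1), a * b ∈ W n :=
    fun n => hnext_mul _ (hW n)
  have hW1 : ∀ n, (1 : G) ∈ W n := fun n => mem_of_mem_nhds (hW n)
  have hanti : Antitone W := antitone_nat_of_succ_le fun n a ha => by
    simpa using hWmul n a ha 1 (hW1 (n + 1))
  have hx : ∀ n, ∃ x ∈ W (n + 1), x⁻¹ ∉ U := by
    intro n
    by_contra! h
    exact hcon (mem_of_superset (hW (n + 1)) h)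
  choose x hxW hxU using hx
  let y : ℕ → G := fun n => ∏ j ∈ Finset.range n, x j
  have htail : ∀ n k, ∏ j ∈ Finset.range n, x (k + j) ∈ W k := by
    intro n
    induction n with
    | zero => intro k; simpa using hW1 k
    | succ n ih =>
      intro k
      rw [Finset.prod_range_succ']
      refine hWmul k _ ?_ _ (hxW k)
      have := ih (k + 1)
      simpa only [add_assoc, add_comm 1] using this
  have hy0 : ∀ n, y n ∈ W 0 := fun n => by simpa using htail n 0
  obtain ⟨z, -, hz⟩ := (hWc 0).exists_mapClusterPt (f := atTop) (u := y)
    (tendsto_principal.2 (Eventually.of_forall hy0))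
  have hyz : ∀ k, (y k)⁻¹ * z ∈ W k := by
    intro k
    have hcl : IsClosed {w : G | (y k)⁻¹ * w ∈ W k} :=
      (hWc k).isClosed.preimage (continuous_const_mul _)
    refine hcl.mem_of_mapClusterPt hz ?_
    filter_upwards [eventually_ge_atTop k] with n hn
    obtain ⟨m, rfl⟩ := Nat.exists_eq_add_of_le hn
    simpa [y, Finset.prod_range_add] using htail m k
  have hnear : {w : G | z⁻¹ * w ∈ W 0} ∈ 𝓝 z :=
    (continuous_const_mul z⁻¹).continuousAt.preimage_mem_nhds (by simpa using hW 0)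
  obtain ⟨k, hk⟩ := (hz.frequently hnear).exists
  refine hxU k ?_
  have key := hnext_mul U hU _ (hanti (Nat.zero_le (k + 1)) (hyz (k + 1))) _ hk
  have hyk : y (k + 1) = y k * x k := Finset.prod_range_succ _ _
  have heq : (y (k + 1))⁻¹ * z * (z⁻¹ * y k) = (x k)⁻¹ := by
    rw [hyk]; group
  rwa [heq] at key

/-- A locally compact Hausdorff abelian group with continuous multiplication is a topological
group. -/
theorem isTopologicalGroup_of_continuousMul (G : Type*) [CommGroup G] [TopologicalSpace G]
    [T2Space G] [WeaklyLocallyCompactSpace G] [ContinuousMul G] : IsTopologicalGroup G where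
  continuous_inv := by
    have h1 : Tendsto (fun x : G => x⁻¹) (𝓝 1) (𝓝 1) :=
      fun U hU => inv_mem_nhds_one_of_continuousMul hU
    refine continuous_iff_continuousAt.2 fun a => ?_
    have h2 : Tendsto (fun x : G => a⁻¹ * x) (𝓝 a) (𝓝 1) := by
      simpa using (continuous_const_mul a⁻¹).tendsto a
    have h3 := (h1.comp h2).const_mul a⁻¹
    simpa [ContinuousAt, Function.comp_def] using h3

/-- A nonempty commutative cancellative semigroup embeds into a group of quotients. -/
theorem exists_injective_mulHom_commGroup (S : Type*) [CommSemigroup S] [IsCancelMul S]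
    [Nonempty S] : ∃ i : S →ₙ* Algebra.GrothendieckGroup (WithOne S),
      Function.Injective i ∧ ∀ g, ∃ s t, g * i t = i s := by
  let f := Localization.monoidOf (⊤ : Submonoid (WithOne S))
  refine ⟨⟨fun s => f (s : WithOne S), fun s t => by simp⟩, ?_, ?_⟩
  · intro s t hst
    obtain ⟨⟨c, _⟩, hc⟩ := f.eq_iff_exists.1 hst
    induction c with
    | one => simpa using hc
    | coe c => exact mul_left_cancel (WithOne.coe_inj.1 (by simpa using hc))
  · intro g
    obtain ⟨⟨p, ⟨q, _⟩⟩, h⟩ := f.surj g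
    obtain ⟨a⟩ := ‹Nonempty S›
    have hcoe : ∀ p : WithOne S, ∃ s : S, (s : WithOne S) = p * a := by
      intro p
      induction p with
      | one => exact ⟨a, by simp⟩
      | coe p => exact ⟨p * a, by simp⟩
    obtain ⟨s, hs⟩ := hcoe p
    obtain ⟨t, ht⟩ := hcoe q
    refine ⟨s, t, ?_⟩
    change g * f t = f s
    rw [hs, ht, map_mul, map_mul, ← mul_assoc]
    exact congrArg (· * f a) h

/-- The finest topology on `G` for which all maps `s ↦ g * i s` are continuous. -/
abbrev translateTopology {S G : Type*} [TopologicalSpace S] [Mul G] (i : S → G) :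
    TopologicalSpace G :=
  ⨆ g : G, TopologicalSpace.coinduced (fun s => g * i s) inferInstance

section translateTopology

variable {S G : Type*} [CommSemigroup S] [TopologicalSpace S] [CommGroup G] {i : S →ₙ* G}

theorem isOpen_translateTopology_iff {A : Set G} :
    IsOpen[translateTopology i] A ↔ ∀ g : G, IsOpen {s : S | g * i s ∈ A} :=
  isOpen_iSup_iff.trans (forall_congr' fun _ => isOpen_coinduced)

theorem isOpenEmbedding_translateTopology [ContinuousMul S] (hi : Function.Injective i)
    (hq : ∀ g, ∃ s t, g * i t = i s) (ho : ∀ a : S, IsOpenMap fun s : S => a * s) (c : G) :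
    @IsOpenEmbedding S G _ (translateTopology i) (fun s => c * i s) := by
  let _ : TopologicalSpace G := translateTopology i
  refine .of_continuous_injective_isOpenMap ?_ ?_ ?_
  · exact continuous_def.2 fun A hA => isOpen_translateTopology_iff.1 hA c
  · exact fun s t hst => hi (mul_left_cancel hst)
  · intro U hU
    refine isOpen_translateTopology_iff.2 fun g => ?_
    obtain ⟨p, q, hpq⟩ := hq (c⁻¹ * g)
    have hset : {s : S | g * i s ∈ (fun s => c * i s) '' U} =
        (fun s => p * s) ⁻¹' ((fun u => q * u) '' U) := by
      ext s
      simp only [mem_ofPred_eq, mem_image, mem_preimage]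
      refine exists_congr fun u => and_congr_right fun _ => ?_
      rw [← hi.eq_iff, map_mul, map_mul, ← hpq, mul_comm _ (i q), mul_assoc, mul_right_inj,
        mul_assoc, eq_inv_mul_iff_mul_eq]
    rw [hset]
    exact (ho q U hU).preimage (continuous_const_mul p)

theorem continuousMul_translateTopology [Nonempty S] [ContinuousMul S]
    (hi : Function.Injective i) (hq : ∀ g, ∃ s t, g * i t = i s)
    (ho : ∀ a : S, IsOpenMap fun s : S => a * s) :
    @ContinuousMul G (translateTopology i) _ := by
  let _ : TopologicalSpace G := translateTopology i
  have hemb := isOpenEmbedding_translateTopology hi hq ho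
  refine ⟨continuous_iff_continuousAt.2 ?_⟩
  rintro ⟨g, h⟩
  obtain ⟨a⟩ := ‹Nonempty S›
  obtain ⟨c, rfl⟩ := (Group.mulRight_bijective (i a)).surjective g
  obtain ⟨d, rfl⟩ := (Group.mulRight_bijective (i a)).surjective h
  refine (((hemb c).prodMap (hemb d)).continuousAt_iff (x := (a, a))).1 ?_
  have hcont : Continuous fun x : S × S => c * d * i (x.1 * x.2) :=
    (hemb (c * d)).continuous.comp continuous_mul
  refine (hcont.congr fun x => ?_).continuousAt
  simp [map_mul, mul_mul_mul_comm]

theorem t2Space_translateTopology [T2Space S] [ContinuousMul S]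
    (hi : Function.Injective i) (hq : ∀ g, ∃ s t, g * i t = i s)
    (ho : ∀ a : S, IsOpenMap fun s : S => a * s) :
    @T2Space G (translateTopology i) := by
  let _ : TopologicalSpace G := translateTopology i
  have hemb := isOpenEmbedding_translateTopology hi hq ho
  refine ⟨fun g h hgh => ?_⟩
  obtain ⟨p, q, hpq⟩ := hq g
  obtain ⟨p', q', hpq'⟩ := hq h
  have hg : (i (q * q'))⁻¹ * i (p * q') = g := by
    rw [inv_mul_eq_iff_eq_mul, map_mul, map_mul, ← hpq, mul_comm g, mul_right_comm]
  have hh : (i (q * q'))⁻¹ * i (p' * q) = h := by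
    rw [inv_mul_eq_iff_eq_mul, map_mul, map_mul, ← hpq', mul_assoc, mul_comm h,
      mul_comm (i q')]
  have hne : p * q' ≠ p' * q := by
    intro heq
    rw [← hg, ← hh, heq] at hgh
    exact hgh rfl
  obtain ⟨U, V, hU, hV, hpU, hpV, hUV⟩ := t2_separation hne
  refine ⟨_, _, (hemb (i (q * q'))⁻¹).isOpenMap U hU, (hemb (i (q * q'))⁻¹).isOpenMap V hV,
    ⟨_, hpU, hg⟩, ⟨_, hpV, hh⟩, ?_⟩
  exact (disjoint_image_iff (hemb _).injective).2 hUV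

theorem weaklyLocallyCompactSpace_translateTopology [Nonempty S] [WeaklyLocallyCompactSpace S]
    [ContinuousMul S] (hi : Function.Injective i) (hq : ∀ g, ∃ s t, g * i t = i s)
    (ho : ∀ a : S, IsOpenMap fun s : S => a * s) :
    @WeaklyLocallyCompactSpace G (translateTopology i) := by
  let _ : TopologicalSpace G := translateTopology i
  have hemb := isOpenEmbedding_translateTopology hi hq ho
  refine ⟨fun g => ?_⟩
  obtain ⟨a⟩ := ‹Nonempty S›
  obtain ⟨c, rfl⟩ := (Group.mulRight_bijective (i a)).surjective g
  obtain ⟨C, hC, hCa⟩ := exists_compact_mem_nhds a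
  exact ⟨_, hC.image (hemb c).continuous, (hemb c).isOpenMap.image_mem_nhds hCa⟩

end translateTopology

/-- If all continuous real-valued functions on a locally compact group are bounded on `A`, then
`A` is contained in a compact set. -/
theorem exists_isCompact_superset_of_bounded {G : Type*} [Group G] [TopologicalSpace G]
    [IsTopologicalGroup G] [T2Space G] [LocallyCompactSpace G] {A : Set G}
    (hA : ∀ f : G → ℝ, Continuous f → ∃ M : ℝ, ∀ x ∈ A, |f x| ≤ M) :
    ∃ C : Set G, IsCompact C ∧ A ⊆ C := by
  by_contra! hcon
  obtain ⟨V, hVc, hV⟩ := exists_compact_mem_nhds (1 : G)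
  obtain ⟨x, hxA, hx⟩ := exists_seq_of_forall_finset_exists (· ∈ A)
    (fun x y => x⁻¹ * y ∉ V) (fun s _ => by
      obtain ⟨y, hyA, hy⟩ := not_subset.1 (hcon (⋃ x ∈ s, (fun v => x * v) '' V)
        (s.isCompact_biUnion fun x _ => hVc.image (continuous_const_mul x)))
      refine ⟨y, hyA, fun x hxs hxy => hy ?_⟩
      exact mem_biUnion hxs ⟨_, hxy, by simp⟩)
  obtain ⟨W, hWo, hW1, hW⟩ : ∃ W : Set G, IsOpen W ∧ (1 : G) ∈ W ∧
      ∀ a ∈ W, ∀ b ∈ W, ∀ c ∈ W, ∀ d ∈ W, a * b⁻¹ * (c * d⁻¹) ∈ V := by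
    have hc : Continuous fun p : (G × G) × (G × G) => p.1.1 * p.1.2⁻¹ * (p.2.1 * p.2.2⁻¹) := by
      fun_prop
    have h := hc.continuousAt.preimage_mem_nhds
      (x := ((1, 1), (1, 1))) (t := V) (by simpa using hV)
    rw [nhds_prod_eq, nhds_prod_eq] at h
    obtain ⟨P, hP, hPV⟩ := mem_prod_self_iff.1 h
    obtain ⟨Q, hQ, hQP⟩ := mem_prod_self_iff.1 hP
    obtain ⟨W, hWQ, hWo, hW1⟩ := mem_nhds_iff.1 hQ
    refine ⟨W, hWo, hW1, fun a ha b hb c hc d hd => ?_⟩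
    exact hPV (show ((a, b), (c, d)) ∈ P ×ˢ P from
      ⟨hQP ⟨hWQ ha, hWQ hb⟩, hQP ⟨hWQ hc, hWQ hd⟩⟩)
  have huniq : ∀ g m n a b, a ∈ W → b ∈ W → (x m)⁻¹ * (g * a) ∈ W → (x n)⁻¹ * (g * b) ∈ W →
      m = n := by
    have hlt : ∀ g m n a b, a ∈ W → b ∈ W → (x m)⁻¹ * (g * a) ∈ W →
        (x n)⁻¹ * (g * b) ∈ W → ¬ m < n := by
      intro g m n a b ha hb hm hn hmn
      refine hx m n hmn ?_
      convert hW _ hm _ ha _ hb _ hn using 1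
      group
    intro g m n a b ha hb hm hn
    exact le_antisymm (not_lt.1 (hlt g n m b a hb ha hn hm)) (not_lt.1 (hlt g m n a b ha hb hm hn))
  obtain ⟨φ, hφ1, hφ0, -, -⟩ := exists_continuous_one_zero_of_isCompact
    (isCompact_singleton (x := (1 : G))) hWo.isClosed_compl
    (disjoint_singleton_left.2 (by simpa using hW1))
  have hφW : ∀ g, φ g ≠ 0 → g ∈ W := fun g hg => by
    by_contra hgW
    exact hg (hφ0 hgW)
  obtain ⟨M, hM⟩ := hA (fun g => ∑ᶠ n : ℕ, (n : ℝ) * φ ((x n)⁻¹ * g)) (by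
    refine continuous_finsum (fun n => by fun_prop) fun g => ?_
    refine ⟨(fun a => g⁻¹ * a) ⁻¹' W,
      (continuous_const_mul g⁻¹).continuousAt.preimage_mem_nhds
        (by simpa using hWo.mem_nhds hW1), ?_⟩
    refine Set.Subsingleton.finite ?_
    rintro m ⟨a, ham, haW⟩ n ⟨b, hbn, hbW⟩
    refine huniq g m n (g⁻¹ * a) (g⁻¹ * b) haW hbW ?_ ?_
    · simpa using hφW _ (right_ne_zero_of_mul ham)
    · simpa using hφW _ (right_ne_zero_of_mul hbn))
  obtain ⟨n, hn⟩ := exists_nat_gt M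
  have hval := hM (x n) (hxA n)
  rw [finsum_eq_single _ n] at hval
  · have h1 : φ 1 = 1 := hφ1 rfl
    rw [inv_mul_cancel, h1, mul_one, Nat.abs_cast] at hval
    exact hn.not_ge hval
  · intro m hmn
    by_contra h
    refine hmn (huniq (x n) m n 1 1 hW1 hW1 ?_ (by simpa using hW1))
    simpa using hφW _ (right_ne_zero_of_mul h)

/-- A space with a dense-range inducing map into a compact group has countable cellularity. -/
theorem countable_of_isInducing_denseRange {X H : Type*} [TopologicalSpace X] [Group H]
    [TopologicalSpace H] [IsTopologicalGroup H] [CompactSpace H] {j : X → H}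
    (hj : IsInducing j) (hd : DenseRange j) {F : Set (Set X)}
    (hF : ∀ U ∈ F, IsOpen U ∧ U.Nonempty) (hdisj : F.Pairwise Disjoint) : F.Countable := by
  let _ : MeasurableSpace H := borel H
  have _ : BorelSpace H := ⟨rfl⟩
  let μ : MeasureTheory.Measure H := MeasureTheory.Measure.haar
  have hex : ∀ U : F, ∃ O : Set H, IsOpen O ∧ j ⁻¹' O = U := fun U =>
    hj.isOpen_iff.1 (hF U U.2).1
  choose O hO hOU using hex
  have hOne : ∀ U, (O U).Nonempty := by
    intro U
    obtain ⟨x, hx⟩ := (hF U U.2).2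
    rw [← hOU U] at hx
    exact ⟨_, hx⟩
  have hOd : Pairwise (Function.onFun Disjoint O) := by
    intro U V hUV
    by_contra hne
    obtain ⟨x, hxU, hxV⟩ := hd.exists_mem_open ((hO U).inter (hO V))
      (not_disjoint_iff_nonempty_inter.1 hne)
    refine Set.disjoint_left.1 (hdisj U.2 V.2 (Subtype.coe_injective.ne hUV))
      (?_ : x ∈ (U : Set X)) ?_
    · rwa [← hOU U]
    · rwa [← hOU V]
  have hcount := MeasureTheory.Measure.countable_meas_pos_of_disjoint_iUnion (μ := μ)
    (fun U => (hO U).measurableSet) hOd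
  have huniv : {U : F | 0 < μ (O U)} = univ :=
    eq_univ_of_forall fun U => (hO U).measure_pos μ (hOne U)
  rw [huniv] at hcount
  exact countable_coe_iff.1 (countable_univ_iff.1 hcount)

/-- The closure of a nonempty subsemigroup of a compact group is a subgroup. -/
theorem closure_subsemigroup_eq_topologicalClosure {G : Type*} [Group G] [TopologicalSpace G]
    [IsTopologicalGroup G] [CompactSpace G] (T : Subsemigroup G) (hT : (T : Set G).Nonempty) :
    closure (T : Set G) = ((Subgroup.closure (T : Set G)).topologicalClosure : Set G) := by
  refine (closure_mono Subgroup.subset_closure).antisymm ?_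
  obtain ⟨k, hk⟩ := hT
  intro h hh
  have hkh : k⁻¹ * h ∈ closure (Submonoid.closure (T : Set G) : Set G) := by
    rw [closure_submonoidClosure_eq_closure_subgroupClosure]
    exact (Subgroup.closure (T : Set G)).topologicalClosure.mul_mem
      (inv_mem (subset_closure (Subgroup.subset_closure hk))) hh
  have hmaps : MapsTo (fun g => k * g) (Submonoid.closure (T : Set G)) T := by
    intro g hg
    induction hg using Submonoid.closure_induction_right with
    | one => simpa using hk
    | mul_right x _ y hy hx =>
      simp only [← mul_assoc]
      exact T.mul_mem hx hy
  simpa using map_mem_closure (continuous_const_mul k) hkh hmaps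

/-- A semigroup carrying the topology induced by a homomorphism into a compact group has countable
cellularity. -/
theorem countable_of_isInducing_mulHom {K G : Type*} [Semigroup K] [TopologicalSpace K] [Group G]
    [TopologicalSpace G] [IsTopologicalGroup G] [CompactSpace G] {i : K →ₙ* G} (hi : IsInducing i)
    {F : Set (Set K)} (hF : ∀ U ∈ F, IsOpen U ∧ U.Nonempty) (hdisj : F.Pairwise Disjoint) :
    F.Countable := by
  rcases isEmpty_or_nonempty K with hK | hK
  · exact F.to_countable
  let T : Subsemigroup G := i.srange
  have hT : (T : Set G).Nonempty := range_nonempty i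
  let H : Subgroup G := (Subgroup.closure (T : Set G)).topologicalClosure
  have hcl : closure (T : Set G) = H := closure_subsemigroup_eq_topologicalClosure T hT
  have : CompactSpace H :=
    isCompact_iff_compactSpace.1 (Subgroup.isClosed_topologicalClosure _).isCompact
  have hmem : ∀ k : K, i k ∈ H := fun k =>
    subset_closure (Subgroup.subset_closure ⟨k, rfl⟩)
  let j : K → H := fun k => ⟨i k, hmem k⟩
  have hj : IsInducing j :=
    .of_comp (g := ((↑) : H → G)) (hi.continuous.subtype_mk _) continuous_subtype_val hi
  have hd : DenseRange j := by
    intro h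
    rw [closure_subtype, ← range_comp]
    change (h : G) ∈ closure (T : Set G)
    rw [hcl]
    exact h.2
  exact countable_of_isInducing_denseRange hj hd hF hdisj

/-- Let `S` be a commutative cancellative locally compact pseudocompact
Hausdorff topological semigroup with open shifts and let `K` be any subsemigroup of `S`.
Then `K`, with the subspace topology, has countable cellularity: every pairwise disjoint
family of nonempty open subsets of `K` is countable. -/
theorem countable_cellularity_of_subsemigroup
    {S : Type*} [CommSemigroup S] [IsCancelMul S] [TopologicalSpace S]
    [T2Space S] [WeaklyLocallyCompactSpace S] [ContinuousMul S]
    (hpc : ∀ f : S → ℝ, Continuous f → ∃ M : ℝ, ∀ s : S, |f s| ≤ M)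
    (ho : ∀ a : S, IsOpenMap fun s : S => a * s)
    (K : Subsemigroup S) :
    ∀ F : Set (Set K), (∀ U ∈ F, IsOpen U ∧ U.Nonempty) →
      F.Pairwise Disjoint → F.Countable := by
  intro F hF hdisj
  rcases isEmpty_or_nonempty K with hK | ⟨⟨k₀, -⟩⟩
  · exact F.to_countable
  have : Nonempty S := ⟨k₀⟩
  obtain ⟨i, hi, hq⟩ := exists_injective_mulHom_commGroup S
  let G := Algebra.GrothendieckGroup (WithOne S)
  let : TopologicalSpace G := translateTopology i
  have : ContinuousMul G := continuousMul_translateTopology hi hq ho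
  have : T2Space G := t2Space_translateTopology hi hq ho
  have : WeaklyLocallyCompactSpace G := weaklyLocallyCompactSpace_translateTopology hi hq ho
  have : IsTopologicalGroup G := isTopologicalGroup_of_continuousMul G
  have hemb : IsOpenEmbedding i := by
    simpa using isOpenEmbedding_translateTopology hi hq ho 1
  obtain ⟨C, hC, hiC⟩ := exists_isCompact_superset_of_bounded (A := range i) fun f hf => by
    obtain ⟨M, hM⟩ := hpc (f ∘ i) (hf.comp hemb.continuous)
    exact ⟨M, forall_mem_range.2 hM⟩
  have : CompactSpace G := by
    refine ⟨?_⟩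
    convert (hC.prod hC).image (f := fun p : G × G => p.1 * p.2⁻¹) (by fun_prop)
    refine (eq_univ_of_forall fun g => ?_).symm
    obtain ⟨s, t, hst⟩ := hq g
    exact ⟨(i s, i t), ⟨hiC ⟨s, rfl⟩, hiC ⟨t, rfl⟩⟩, by simp [← hst]⟩
  exact countable_of_isInducing_mulHom (i := i.comp (MulMemClass.subtype K))
    (hemb.isInducing.comp .subtypeVal) hF hdisj
end
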